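/- arXiv:1804.05988 — 7 statements merged into one kernel-verified Lean document; each statement's English description precedes it below -/
import Mathlib

section
/- Let A be the weighted adjacency matrix of an undirected weighted graph without loops, and let S₁, …, S_p be pairwise disjoint subsets of vertices, with |S_t| = m_t ≥ 2, such that each S_t carries an (m_t,k_t,s_t)-star with the same central weight a. Then −a is an eigenvalue of A and the eigenspace ker(A + a·I) has dimension at least Σ_{t=1}^{p} (m_t − 1). -/
/-- If `i` and `j` are twins of mutual weight `a`, then `e_i - e_j` is an eigenvector for `-a`. -/
lemma single_sub_single_mem_eigenspace {n : Type*} [Fintype n] [DecidableEq n]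
    {A : Matrix n n ℝ} (hsymm : A.IsSymm) (hdiag : ∀ i, A i i = 0) {a : ℝ} {i j : n}
    (hij : A i j = a) (hout : ∀ l, l ≠ i → l ≠ j → A i l = A j l) :
    (Pi.single i 1 - Pi.single j 1 : n → ℝ) ∈
      Module.End.eigenspace (Matrix.toLin' A) (-a) := by
  rw [Module.End.mem_eigenspace_iff, Matrix.toLin'_apply, Matrix.mulVec_sub]
  ext l
  simp only [Matrix.mulVec_single_one, Pi.sub_apply, Pi.smul_apply, smul_eq_mul,
    Pi.single_apply, Matrix.col_apply]
  by_cases hli : l = i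
  · subst hli
    by_cases hlj : l = j
    · simp [hlj]
    · simp [hlj, hdiag, hij]
  · by_cases hlj : l = j
    · subst hlj
      simp [hli, hdiag, ← hij, hsymm.apply i l]
    · simp [hli, hlj, ← hsymm.apply l i, ← hsymm.apply l j, hout l hli hlj]

/-- For disjoint sets `S t` with base points `c t ∈ S t`, the vectors `e_i - e_{c t}` with
`i ∈ S t`, `i ≠ c t`, are linearly independent. -/
lemma linearIndependent_single_sub_single {n τ : Type*} [DecidableEq n] [Fintype τ]
    (S : τ → Finset n) (hdisj : ∀ t t', t ≠ t' → Disjoint (S t) (S t'))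
    (c : τ → n) (hc : ∀ t, c t ∈ S t) :
    LinearIndependent ℝ (fun x : Σ t, ((S t).erase (c t)) =>
      (Pi.single (x.2 : n) 1 - Pi.single (c x.1) 1 : n → ℝ)) := by
  classical
  have htt : ∀ {t t' i}, i ∈ S t → i ∈ S t' → t = t' := fun h h' => by
    by_contra hne
    exact Finset.disjoint_left.mp (hdisj _ _ hne) h h'
  rw [Fintype.linearIndependent_iff]
  rintro g hg ⟨t, i, hi⟩
  have hev := congrFun hg i
  rw [Finset.sum_apply, Finset.sum_eq_single ⟨t, i, hi⟩] at hev
  · simpa [(Finset.mem_erase.mp hi).1] using hev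
  · rintro ⟨t', j, hj⟩ - hne
    have hic : i ≠ c t' := fun h => by
      have : t = t' := htt (Finset.mem_of_mem_erase hi) (h ▸ hc t')
      subst this
      exact (Finset.mem_erase.mp hi).1 h
    have hij : i ≠ j := fun h => by
      subst h
      have : t = t' := htt (Finset.mem_of_mem_erase hi) (Finset.mem_of_mem_erase hj)
      subst this
      exact hne rfl
    simp [hic, hij]
  · simp

/-- If pairwise disjoint subsets `S 1, …, S p` (each of size `m t ≥ 2`) of a
loopless weighted graph each carry an `(m_t,k_t,s_t)`-star with the same central weight `a`,
then `-a` is an eigenvalue of the adjacency matrix `A` and the eigenspace `ker (A + a•I)`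
has dimension at least `∑ (m t - 1)`. -/
theorem stmt_1 {n p : ℕ} (hp : 0 < p) (A : Matrix (Fin n) (Fin n) ℝ)
    (hsymm : A.IsSymm)
    (hnonneg : ∀ i j, 0 ≤ A i j)
    (hdiag : ∀ i, A i i = 0)
    (S : Fin p → Finset (Fin n)) (m : Fin p → ℕ)
    (hm : ∀ t, 2 ≤ m t) (hcard : ∀ t, (S t).card = m t)
    (hdisj : ∀ t t', t ≠ t' → Disjoint (S t) (S t'))
    (a : ℝ) (ha : 0 ≤ a)
    (hstar_center : ∀ t, ∀ i ∈ S t, ∀ j ∈ S t, i ≠ j → A i j = a)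
    (hstar_out : ∀ t, ∀ i ∈ S t, ∀ j ∈ S t, ∀ l, l ∉ S t → A i l = A j l) :
    Module.End.HasEigenvalue (Matrix.toLin' A) (-a) ∧
    (∑ t, (m t - 1)) ≤
      Module.finrank ℝ (Module.End.eigenspace (Matrix.toLin' A) (-a)) := by
  have hne : ∀ t, (S t).Nonempty := fun t => by
    rw [← Finset.card_pos, hcard]
    exact lt_of_lt_of_le two_pos (hm t)
  choose c hc using hne
  have hmem : ∀ x : Σ t, ((S t).erase (c t)),
      (Pi.single (x.2 : Fin n) 1 - Pi.single (c x.1) 1 : Fin n → ℝ) ∈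
        Module.End.eigenspace (Matrix.toLin' A) (-a) := by
    rintro ⟨t, i, hi⟩
    obtain ⟨hic, hiS⟩ := Finset.mem_erase.mp hi
    refine single_sub_single_mem_eigenspace hsymm hdiag
      (hstar_center t i hiS (c t) (hc t) hic) fun l hli hlc => ?_
    by_cases hl : l ∈ S t
    · rw [hstar_center t i hiS l hl hli.symm, hstar_center t _ (hc t) l hl hlc.symm]
    · exact hstar_out t i hiS _ (hc t) l hl
  have hli : LinearIndependent ℝ (fun x => (⟨_, hmem x⟩ :
      Module.End.eigenspace (Matrix.toLin' A) (-a))) :=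
    LinearIndependent.of_comp (Submodule.subtype _)
      (linearIndependent_single_sub_single S hdisj c hc)
  have hdim : (∑ t, (m t - 1)) ≤
      Module.finrank ℝ (Module.End.eigenspace (Matrix.toLin' A) (-a)) := by
    simpa only [Fintype.card_sigma, Fintype.card_coe, Finset.card_erase_of_mem, hc, hcard] using
      hli.fintype_card_le_finrank
  refine ⟨fun hbot => ?_, hdim⟩
  have hpos : 0 < ∑ t, (m t - 1) :=
    Finset.sum_pos (fun t _ => Nat.sub_pos_of_lt (hm t)) ⟨⟨0, hp⟩, Finset.mem_univ _⟩
  have hzero : Module.finrank ℝ (Module.End.eigenspace (Matrix.toLin' A) (-a)) = 0 := by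
    rw [Module.End.eigenspace, hbot, finrank_bot]
  omega
end

section
/- (Loop removal theorem, reduction step, adjacency matrix.) Let A be an n×n real symmetric matrix carrying on a subset S, |S| = m ≥ 2, an (m,k,s)-star with loops with loop weight ℓ and central weight a. Let A⁻ be the (n−m+1)×(n−m+1) reduced adjacency matrix obtained by collapsing S to a single vertex ⋆: A⁻ ⋆ ⋆ = (m−1)a + ℓ, A⁻ ⋆ j = A⁻ j ⋆ = √m · (A i₀ j) for j ∉ S (where i₀ ∈ S is arbitrary), and A⁻ j j' = A j j' for j, j' ∉ S. Let H be the n×(n−m+1) matrix with H i ⋆ = 1/√m for i ∈ S, H j j = 1 for j ∉ S, and all other entries 0. Then Hᵀ H = I, Hᵀ A H = A⁻, and A H = H A⁻. -/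
open Matrix

/-- The sum of a row of `A` over a set on which the diagonal entry is `ℓ` and all other entries
are `a`. -/
lemma sum_eq_of_diag_of_offDiag {ι : Type*} [DecidableEq ι] {S : Finset ι} {i : ι} (hi : i ∈ S)
    {f : ι → ℝ} {ℓ a : ℝ} (hdiag : f i = ℓ) (hoff : ∀ j ∈ S, i ≠ j → f j = a) :
    ∑ j ∈ S, f j = ((S.card : ℝ) - 1) * a + ℓ := by
  rw [← Finset.sum_erase_add _ _ hi, hdiag,
    Finset.sum_congr rfl fun j hj => hoff j (Finset.mem_of_mem_erase hj)
      (Finset.ne_of_mem_erase hj).symm,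
    Finset.sum_const, nsmul_eq_mul, Finset.cast_card_erase_of_mem hi]

/-- Loop removal, reduction step, adjacency matrix: collapsing an
`(m,k,s)`-star with loops on `S` (loop weight `ℓ`, central weight `a`) to a single vertex
`⋆` (the `none` vertex of `Option {j // j ∉ S}`), with loop weight `(m-1)a + ℓ` at `⋆` and
weights `√m · A i₀ j` from `⋆` to outside vertices, yields the reduced matrix `Am`; the
`n × (n-m+1)` matrix `H` with `H i ⋆ = 1/√m` for `i ∈ S` and `H j j = 1` for `j ∉ S`
satisfies `Hᵀ H = 1`, `Hᵀ A H = Am` and `A H = H Am`. -/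
theorem stmt_10 {n : ℕ} (A : Matrix (Fin n) (Fin n) ℝ)
    (hsymm : A.IsSymm)
    (hnonneg : ∀ i j, 0 ≤ A i j)
    (S : Finset (Fin n)) (m : ℕ) (hm : 2 ≤ m) (hcard : S.card = m)
    (ℓ a : ℝ) (hℓ : 0 ≤ ℓ) (ha : 0 ≤ a)
    (hloop : ∀ i ∈ S, A i i = ℓ)
    (hstar_center : ∀ i ∈ S, ∀ j ∈ S, i ≠ j → A i j = a)
    (hstar_out : ∀ i ∈ S, ∀ j ∈ S, ∀ l, l ∉ S → A i l = A j l)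
    (i₀ : Fin n) (hi₀ : i₀ ∈ S)
    (Am : Matrix (Option {j : Fin n // j ∉ S}) (Option {j : Fin n // j ∉ S}) ℝ)
    (hAm_star : Am none none = ((m : ℝ) - 1) * a + ℓ)
    (hAm_out : ∀ j : {j : Fin n // j ∉ S},
      Am none (some j) = Real.sqrt m * A i₀ (j : Fin n) ∧
      Am (some j) none = Real.sqrt m * A i₀ (j : Fin n))
    (hAm_rest : ∀ j j' : {j : Fin n // j ∉ S},
      Am (some j) (some j') = A (j : Fin n) (j' : Fin n))
    (H : Matrix (Fin n) (Option {j : Fin n // j ∉ S}) ℝ)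
    (hH_star : ∀ i, H i none = if i ∈ S then 1 / Real.sqrt m else 0)
    (hH_rest : ∀ i, ∀ j : {j : Fin n // j ∉ S},
      H i (some j) = if i = (j : Fin n) then 1 else 0) :
    Hᵀ * H = 1 ∧ Hᵀ * A * H = Am ∧ A * H = H * Am := by
  have hmpos : (0 : ℝ) < m := by exact_mod_cast (by omega : 0 < m)
  have hsq : √(m : ℝ) * √(m : ℝ) = m := Real.mul_self_sqrt hmpos.le
  have hne : √(m : ℝ) ≠ 0 := (Real.sqrt_pos.mpr hmpos).ne'
  have hHH : Hᵀ * H = 1 := by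
    ext x y
    rw [Matrix.mul_apply]
    rcases x with _ | x <;> rcases y with _ | y
    · simp only [transpose_apply, hH_star, mul_ite, ite_mul, zero_mul, mul_zero, one_apply_eq]
      simp only [← ite_and, and_self, Finset.sum_ite_mem, Finset.univ_inter, Finset.sum_const,
        nsmul_eq_mul, hcard]
      field_simp
      linarith
    · simp [hH_star, hH_rest, y.2]
    · simp [hH_star, hH_rest, x.2]
    · simp [hH_rest, Matrix.one_apply, Subtype.ext_iff, eq_comm]
  have hAH_star (i : Fin n) : (A * H) i none = (∑ l ∈ S, A i l) * (1 / √(m : ℝ)) := by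
    simp [Matrix.mul_apply, hH_star, Finset.sum_mul]
  have hAH_rest (i : Fin n) (j : {j : Fin n // j ∉ S}) : (A * H) i (some j) = A i j := by
    simp [Matrix.mul_apply, hH_rest]
  have hHAm_mem (i : Fin n) (hi : i ∈ S) (x : Option {j : Fin n // j ∉ S}) :
      (H * Am) i x = 1 / √(m : ℝ) * Am none x := by
    have h (j : {j : Fin n // j ∉ S}) : i ≠ j := fun h => j.2 (h ▸ hi)
    simp [Matrix.mul_apply, Fintype.sum_option, hH_star, hH_rest, hi, h]
  have hHAm_notMem (j : {j : Fin n // j ∉ S}) (x : Option {j : Fin n // j ∉ S}) :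
      (H * Am) j x = Am (some j) x := by
    simp [Matrix.mul_apply, Fintype.sum_option, hH_star, hH_rest, j.2, ← Subtype.ext_iff]
  have hAH : A * H = H * Am := by
    ext i x
    by_cases hi : i ∈ S
    · rw [hHAm_mem i hi]
      rcases x with _ | j
      · rw [hAH_star, hAm_star,
          sum_eq_of_diag_of_offDiag hi (hloop i hi) (hstar_center i hi), hcard, mul_comm]
      · rw [hAH_rest, (hAm_out j).1, hstar_out i hi i₀ hi₀ j j.2]
        field_simp
    · obtain ⟨j, rfl⟩ : ∃ j : {j : Fin n // j ∉ S}, (j : Fin n) = i := ⟨⟨i, hi⟩, rfl⟩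
      rw [hHAm_notMem]
      rcases x with _ | j'
      · rw [hAH_star, (hAm_out j).2, Finset.sum_congr rfl fun l hl =>
          (hsymm.apply l j).trans (hstar_out l hl i₀ hi₀ j hi), Finset.sum_const, nsmul_eq_mul,
          hcard]
        field_simp
        linear_combination -A i₀ j * hsq
      · rw [hAH_rest, hAm_rest]
  refine ⟨hHH, ?_, hAH⟩
  rw [Matrix.mul_assoc, hAH, ← Matrix.mul_assoc, hHH, Matrix.one_mul]
end

section
/- (Loop removal theorem, reduction step, spectral consequence.) Let A be an n×n real symmetric matrix carrying on a subset S, |S| = m ≥ 2, an (m,k,s)-star with loops with loop weight ℓ and central weight a, let A⁻ be the reduced adjacency matrix obtained by collapsing S to a single vertex ⋆ (with A⁻ ⋆ ⋆ = (m−1)a + ℓ, A⁻ ⋆ j = √m·A i₀ j for j ∉ S, A⁻ unchanged off ⋆), and let H be the n×(n−m+1) matrix with H i ⋆ = 1/√m for i ∈ S, H j j = 1 for j ∉ S, and 0 otherwise. Then every eigenvalue of A⁻ is an eigenvalue of A, and if v is an eigenvector of A⁻ with eigenvalue μ, then Hv is a nonzero eigenvector of A with the same eigenvalue μ. -/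
open Matrix

section Collapse

variable {ι : Type*} [Fintype ι] [DecidableEq ι] {S : Finset ι} {c : ℝ}
  {H : Matrix ι (Option {j : ι // j ∉ S}) ℝ}

lemma collapse_mulVec_of_mem (hH_star : ∀ i, H i none = if i ∈ S then c else 0)
    (hH_rest : ∀ i, ∀ j : {j : ι // j ∉ S}, H i (some j) = if i = (j : ι) then 1 else 0)
    {i : ι} (hi : i ∈ S) (v : Option {j : ι // j ∉ S} → ℝ) :
    (H *ᵥ v) i = c * v none := by
  have hne (j : {j : ι // j ∉ S}) : i ≠ j := fun h => j.2 (h ▸ hi)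
  simp [mulVec, dotProduct, Fintype.sum_option, hH_star, hH_rest, hi, hne]

lemma collapse_mulVec_of_notMem (hH_star : ∀ i, H i none = if i ∈ S then c else 0)
    (hH_rest : ∀ i, ∀ j : {j : ι // j ∉ S}, H i (some j) = if i = (j : ι) then 1 else 0)
    (j : {j : ι // j ∉ S}) (v : Option {j : ι // j ∉ S} → ℝ) :
    (H *ᵥ v) j = v (some j) := by
  simp [mulVec, dotProduct, Fintype.sum_option, hH_star, hH_rest, j.2, ← Subtype.ext_iff]

lemma collapse_mulVec_injective (hc : c ≠ 0) (hS : S.Nonempty)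
    (hH_star : ∀ i, H i none = if i ∈ S then c else 0)
    (hH_rest : ∀ i, ∀ j : {j : ι // j ∉ S}, H i (some j) = if i = (j : ι) then 1 else 0) :
    Function.Injective H.mulVec := by
  intro v w h
  obtain ⟨i, hi⟩ := hS
  funext x
  cases x with
  | none =>
    have := congrFun h i
    rw [collapse_mulVec_of_mem hH_star hH_rest hi,
      collapse_mulVec_of_mem hH_star hH_rest hi] at this
    exact mul_left_cancel₀ hc this
  | some j =>
    have := congrFun h j
    rwa [collapse_mulVec_of_notMem hH_star hH_rest,
      collapse_mulVec_of_notMem hH_star hH_rest] at this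

lemma mulVec_collapse_mulVec (A : Matrix ι ι ℝ)
    (hH_star : ∀ i, H i none = if i ∈ S then c else 0)
    (hH_rest : ∀ i, ∀ j : {j : ι // j ∉ S}, H i (some j) = if i = (j : ι) then 1 else 0)
    (v : Option {j : ι // j ∉ S} → ℝ) (i : ι) :
    (A *ᵥ (H *ᵥ v)) i =
      (∑ j ∈ S, A i j) * (c * v none) + ∑ j : {j : ι // j ∉ S}, A i j * v (some j) := by
  have hout : ∑ j ∈ Sᶜ, A i j * (H *ᵥ v) j =
      ∑ j : {j : ι // j ∉ S}, A i j * (H *ᵥ v) j :=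
    Finset.sum_subtype _ (by simp) _
  rw [mulVec, dotProduct, ← Finset.sum_add_sum_compl S, hout, Finset.sum_mul]
  congr 1
  · exact Finset.sum_congr rfl fun j hj => by
      rw [collapse_mulVec_of_mem hH_star hH_rest hj]
  · exact Finset.sum_congr rfl fun j _ => by
      rw [collapse_mulVec_of_notMem hH_star hH_rest]

end Collapse

/-- Loop removal, reduction step, spectral consequence: with `Am` the reduced
adjacency matrix obtained by collapsing an `(m,k,s)`-star with loops on `S` to the single
vertex `⋆` (= `none`), and `H` the corresponding `n × (n-m+1)` isometry, every eigenvalue of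
`Am` is an eigenvalue of `A`, and if `v` is an eigenvector of `Am` with eigenvalue `μ`, then
`H v` is a nonzero eigenvector of `A` with the same eigenvalue `μ`. -/
theorem stmt_11 {n : ℕ} (A : Matrix (Fin n) (Fin n) ℝ)
    (hsymm : A.IsSymm)
    (hnonneg : ∀ i j, 0 ≤ A i j)
    (S : Finset (Fin n)) (m : ℕ) (hm : 2 ≤ m) (hcard : S.card = m)
    (ℓ a : ℝ) (hℓ : 0 ≤ ℓ) (ha : 0 ≤ a)
    (hloop : ∀ i ∈ S, A i i = ℓ)
    (hstar_center : ∀ i ∈ S, ∀ j ∈ S, i ≠ j → A i j = a)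
    (hstar_out : ∀ i ∈ S, ∀ j ∈ S, ∀ l, l ∉ S → A i l = A j l)
    (i₀ : Fin n) (hi₀ : i₀ ∈ S)
    (Am : Matrix (Option {j : Fin n // j ∉ S}) (Option {j : Fin n // j ∉ S}) ℝ)
    (hAm_star : Am none none = ((m : ℝ) - 1) * a + ℓ)
    (hAm_out : ∀ j : {j : Fin n // j ∉ S},
      Am none (some j) = Real.sqrt m * A i₀ (j : Fin n) ∧
      Am (some j) none = Real.sqrt m * A i₀ (j : Fin n))
    (hAm_rest : ∀ j j' : {j : Fin n // j ∉ S},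
      Am (some j) (some j') = A (j : Fin n) (j' : Fin n))
    (H : Matrix (Fin n) (Option {j : Fin n // j ∉ S}) ℝ)
    (hH_star : ∀ i, H i none = if i ∈ S then 1 / Real.sqrt m else 0)
    (hH_rest : ∀ i, ∀ j : {j : Fin n // j ∉ S},
      H i (some j) = if i = (j : Fin n) then 1 else 0) :
    (∀ μ : ℝ, Module.End.HasEigenvalue (Matrix.toLin' Am) μ →
        Module.End.HasEigenvalue (Matrix.toLin' A) μ) ∧
    (∀ (μ : ℝ) (v : Option {j : Fin n // j ∉ S} → ℝ), v ≠ 0 →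
        Am.mulVec v = μ • v →
        H.mulVec v ≠ 0 ∧ A.mulVec (H.mulVec v) = μ • H.mulVec v) := by
  have hm0 : (0 : ℝ) < m := by exact_mod_cast (by omega : 0 < m)
  have hsq : Real.sqrt m * Real.sqrt m = m := Real.mul_self_sqrt hm0.le
  have hs : Real.sqrt m ≠ 0 := (Real.sqrt_pos.2 hm0).ne'
  have hinj : Function.Injective H.mulVec :=
    collapse_mulVec_injective (one_div_ne_zero hs) ⟨i₀, hi₀⟩ hH_star hH_rest
  have intertwine (v : Option {j : Fin n // j ∉ S} → ℝ) : A *ᵥ (H *ᵥ v) = H *ᵥ (Am *ᵥ v) := by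
    funext i
    rw [mulVec_collapse_mulVec A hH_star hH_rest]
    by_cases hi : i ∈ S
    · have hrow : ∑ j ∈ S, A i j = (m - 1) * a + ℓ := by
        rw [← Finset.sum_erase_add S _ hi, hloop i hi,
          Finset.sum_congr rfl fun j hj => hstar_center i hi j (Finset.mem_of_mem_erase hj)
            (Finset.ne_of_mem_erase hj).symm,
          Finset.sum_const, Finset.card_erase_of_mem hi, hcard, nsmul_eq_mul,
          Nat.cast_sub (by omega), Nat.cast_one]
      rw [collapse_mulVec_of_mem hH_star hH_rest hi, hrow, mulVec, dotProduct,
        Fintype.sum_option, hAm_star, mul_add, Finset.mul_sum]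
      congr 1
      · ring
      · refine Finset.sum_congr rfl fun j _ => ?_
        rw [(hAm_out j).1, hstar_out i hi i₀ hi₀ j j.2]
        field_simp
    · have hrow : ∑ j ∈ S, A i j = m * A i₀ i := by
        rw [Finset.sum_congr rfl fun j hj => (hsymm.apply j i).trans (hstar_out j hj i₀ hi₀ i hi),
          Finset.sum_const, hcard, nsmul_eq_mul]
      rw [collapse_mulVec_of_notMem hH_star hH_rest ⟨i, hi⟩, hrow, mulVec, dotProduct,
        Fintype.sum_option, (hAm_out ⟨i, hi⟩).2]
      congr 1
      · field_simp
        rw [sq, hsq]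
        ring
      · simp only [hAm_rest]
  have lift_eigenvector (μ : ℝ) (v : Option {j : Fin n // j ∉ S} → ℝ) (hv : v ≠ 0)
      (h : Am *ᵥ v = μ • v) : H *ᵥ v ≠ 0 ∧ A *ᵥ (H *ᵥ v) = μ • H *ᵥ v :=
    ⟨fun h0 => hv (hinj (h0.trans (mulVec_zero H).symm)), by
      rw [intertwine, h, mulVec_smul]⟩
  refine ⟨fun μ hμ => ?_, lift_eigenvector⟩
  obtain ⟨v, hv⟩ := hμ.exists_hasEigenvector
  obtain ⟨hne, heq⟩ := lift_eigenvector μ v hv.2 (by simpa using hv.apply_eq_smul)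
  exact Module.End.hasEigenvalue_of_hasEigenvector (x := H *ᵥ v)
    ⟨Module.End.mem_eigenspace_iff.2 (by simpa using heq), hne⟩
end

section
/- (Loop removal theorem, enlargement step, adjacency matrix.) Let A be an n×n real symmetric matrix with a distinguished vertex v₀ whose loop weight is ℓ = A v₀ v₀ ≥ 0, and let q ≥ 1. Let A⁺ be the (n+q)×(n+q) enlarged adjacency matrix obtained by replacing v₀ with a clique C of q+1 vertices: A⁺ i i = 0 and A⁺ i i' = ℓ/q for distinct i, i' ∈ C, A⁺ i j = A⁺ j i = (A v₀ j)/√(q+1) for i ∈ C and j ∉ C, and A⁺ j j' = A j j' for j, j' ∉ C. Let K be the (n+q)×n matrix with K i v₀ = 1/√(q+1) for i ∈ C, K j j = 1 for j ∉ C, and all other entries 0. Then Kᵀ K = I, Kᵀ A⁺ K = A, and A⁺ K = K A. -/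
open Matrix

/-- Loop removal, enlargement step, adjacency matrix: replacing a looped
vertex `v₀` (loop weight `ℓ = A v₀ v₀`) by a loopless clique `C` of `q+1` vertices
(`C = {inl v₀} ∪ range inr` in the vertex set `Fin n ⊕ Fin q`), with pairwise weights `ℓ/q`
inside `C` and weights `A v₀ j / √(q+1)` from `C` to each former neighbor `j`, yields the
enlarged matrix `Ap`; the `(n+q) × n` matrix `K` with `K x v₀ = 1/√(q+1)` for `x ∈ C` and
`K j j = 1` for `j ∉ C` satisfies `Kᵀ K = 1`, `Kᵀ Ap K = A` and `Ap K = K A`. -/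
theorem stmt_12 {n : ℕ} (A : Matrix (Fin n) (Fin n) ℝ)
    (hsymm : A.IsSymm)
    (hnonneg : ∀ i j, 0 ≤ A i j)
    (v₀ : Fin n) (ℓ : ℝ) (hℓ : 0 ≤ ℓ) (hℓdef : A v₀ v₀ = ℓ)
    (q : ℕ) (hq : 1 ≤ q)
    (C : Set (Fin n ⊕ Fin q))
    (hC : C = {Sum.inl v₀} ∪ Set.range Sum.inr)
    (Ap : Matrix (Fin n ⊕ Fin q) (Fin n ⊕ Fin q) ℝ)
    (hAp_diag : ∀ x ∈ C, Ap x x = 0)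
    (hAp_clique : ∀ x ∈ C, ∀ y ∈ C, x ≠ y → Ap x y = ℓ / q)
    (hAp_out : ∀ x ∈ C, ∀ j : Fin n, j ≠ v₀ →
      Ap x (Sum.inl j) = A v₀ j / Real.sqrt (q + 1) ∧
      Ap (Sum.inl j) x = A v₀ j / Real.sqrt (q + 1))
    (hAp_rest : ∀ j j' : Fin n, j ≠ v₀ → j' ≠ v₀ →
      Ap (Sum.inl j) (Sum.inl j') = A j j')
    (K : Matrix (Fin n ⊕ Fin q) (Fin n) ℝ)
    (hK_C : ∀ x ∈ C, K x v₀ = 1 / Real.sqrt (q + 1))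
    (hK_C' : ∀ x ∈ C, ∀ j : Fin n, j ≠ v₀ → K x j = 0)
    (hK_rest : ∀ j : Fin n, j ≠ v₀ → ∀ j' : Fin n,
      K (Sum.inl j) j' = if j' = j then 1 else 0) :
    Kᵀ * K = 1 ∧ Kᵀ * Ap * K = A ∧ Ap * K = K * A := by
  have hinl : Sum.inl v₀ ∈ C := by simp [hC]
  have hinr (i : Fin q) : Sum.inr i ∈ C := by simp [hC]
  have hq0 : (q : ℝ) ≠ 0 := by positivity
  have hs0 : Real.sqrt (q + 1) ≠ 0 := by positivity
  have hss : Real.sqrt (q + 1) * Real.sqrt (q + 1) = q + 1 :=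
    Real.mul_self_sqrt (by positivity)
  have sum_mul_col₀ (f : Fin n ⊕ Fin q → ℝ) :
      ∑ x, f x * K x v₀ = (f (Sum.inl v₀) + ∑ i, f (Sum.inr i)) / Real.sqrt (q + 1) := by
    rw [Fintype.sum_sum_type, Fintype.sum_eq_single v₀, hK_C _ hinl, add_div, Finset.sum_div]
    · simp [hK_C _ (hinr _), div_eq_mul_inv]
    · intro j hj
      simp [hK_rest j hj, hj.symm]
  have sum_mul_col (f : Fin n ⊕ Fin q → ℝ) (k : Fin n) (hk : k ≠ v₀) :
      ∑ x, f x * K x k = f (Sum.inl k) := by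
    rw [Fintype.sum_sum_type, Fintype.sum_eq_single k, hK_rest k hk]
    · simp [hK_C' _ (hinr _) k hk]
    · intro j hj
      by_cases hj₀ : j = v₀
      · subst hj₀
        simp [hK_C' _ hinl k hk]
      · simp [hK_rest j hj₀, hj.symm]
  have sum_row_mem (x : Fin n ⊕ Fin q) (hx : x ∈ C) (g : Fin n → ℝ) :
      ∑ k, K x k * g k = g v₀ / Real.sqrt (q + 1) := by
    rw [Fintype.sum_eq_single v₀, hK_C x hx, one_div, inv_mul_eq_div]
    intro j hj
    simp [hK_C' x hx j hj]
  have sum_row (j : Fin n) (hj : j ≠ v₀) (g : Fin n → ℝ) :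
      ∑ k, K (Sum.inl j) k * g k = g j := by
    simp [hK_rest j hj]
  have hKK : Kᵀ * K = 1 := by
    ext a b
    simp only [mul_apply, transpose_apply]
    by_cases hb : b = v₀
    · subst hb
      rw [sum_mul_col₀]
      by_cases ha : a = b
      · subst ha
        simp only [hK_C _ hinl, hK_C _ (hinr _), one_apply_eq, Finset.sum_const,
          Finset.card_univ, Fintype.card_fin, nsmul_eq_mul]
        field_simp
        linarith
      · simp [hK_C' _ hinl a ha, hK_C' _ (hinr _) a ha, one_apply_ne ha]
    · rw [sum_mul_col _ b hb, hK_rest b hb, one_apply]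
  have hrow (x : Fin n ⊕ Fin q) (hx : x ∈ C) :
      Ap x (Sum.inl v₀) + ∑ i, Ap x (Sum.inr i) = ℓ := by
    rw [hC] at hx
    rcases hx with rfl | ⟨i, rfl⟩
    · simp only [hAp_diag _ hinl, hAp_clique _ hinl _ (hinr _) Sum.inl_ne_inr,
        Finset.sum_const, Finset.card_univ, Fintype.card_fin, nsmul_eq_mul]
      field_simp
      ring
    · have h (k : Fin q) : Ap (Sum.inr i) (Sum.inr k) = ℓ / q - if i = k then ℓ / q else 0 := by
        by_cases hk : i = k
        · subst hk
          simp [hAp_diag _ (hinr i)]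
        · simp [hk, hAp_clique _ (hinr i) _ (hinr k) (by simpa using hk)]
      simp only [h, hAp_clique _ (hinr i) _ hinl Sum.inr_ne_inl, Finset.sum_sub_distrib,
        Finset.sum_ite_eq, Finset.mem_univ, if_true,
        Finset.sum_const, Finset.card_univ, Fintype.card_fin, nsmul_eq_mul]
      field_simp
      ring
  have hAK : Ap * K = K * A := by
    ext x b
    simp only [mul_apply]
    by_cases hx : x ∈ C
    · rw [sum_row_mem x hx]
      by_cases hb : b = v₀
      · subst hb
        rw [sum_mul_col₀, hrow x hx, hℓdef]
      · rw [sum_mul_col _ b hb, (hAp_out x hx b hb).1]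
    · obtain ⟨j, hj, rfl⟩ : ∃ j, j ≠ v₀ ∧ x = Sum.inl j := by
        rcases x with j | i
        · exact ⟨j, fun h => hx (h ▸ hinl), rfl⟩
        · exact absurd (hinr i) hx
      rw [sum_row j hj]
      by_cases hb : b = v₀
      · subst hb
        rw [sum_mul_col₀]
        simp only [(hAp_out _ hinl j hj).2, (hAp_out _ (hinr _) j hj).2, Finset.sum_const,
          Finset.card_univ, Fintype.card_fin, nsmul_eq_mul]
        rw [← hsymm.apply j b]
        field_simp
        rw [sq, hss]
        ring
      · rw [sum_mul_col _ b hb, hAp_rest j b hj hb]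
  exact ⟨hKK, by rw [Matrix.mul_assoc, hAK, ← Matrix.mul_assoc, hKK, Matrix.one_mul], hAK⟩
end

section
/- (Loop removal theorem, enlargement step, spectral consequence.) Let A be an n×n real symmetric matrix with a distinguished vertex v₀ with loop weight ℓ = A v₀ v₀ ≥ 0, let q ≥ 1, let A⁺ be the (n+q)×(n+q) enlarged adjacency matrix obtained by replacing v₀ with a loopless clique C of q+1 vertices with pairwise weights ℓ/q and weights (A v₀ j)/√(q+1) from each vertex of C to each j ∉ C, the rest of A unchanged, and let K be the (n+q)×n matrix with K i v₀ = 1/√(q+1) for i ∈ C, K j j = 1 for j ∉ C, and 0 otherwise. Then every eigenvalue of A is an eigenvalue of A⁺, and if v is an eigenvector of A with eigenvalue μ, then Kv is a nonzero eigenvector of A⁺ with the same eigenvalue μ. -/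
open Matrix

/-- An intertwining relation `B * K = K * A` with `K` injective transports eigenvalues of `A`
to eigenvalues of `B`. -/
theorem hasEigenvalue_toLin'_of_mulVec_intertwine {R m n : Type*} [CommRing R]
    [Fintype m] [DecidableEq m] [Fintype n] [DecidableEq n]
    {A : Matrix n n R} {B : Matrix m m R} {K : Matrix m n R}
    (hK : ∀ v, v ≠ 0 → K *ᵥ v ≠ 0) (hBK : ∀ v, B *ᵥ (K *ᵥ v) = K *ᵥ (A *ᵥ v)) {μ : R}
    (hμ : Module.End.HasEigenvalue (Matrix.toLin' A) μ) :
    Module.End.HasEigenvalue (Matrix.toLin' B) μ := by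
  obtain ⟨v, hv⟩ := hμ.exists_hasEigenvector
  have hAv : A *ᵥ v = μ • v := by simpa using hv.apply_eq_smul
  refine Module.End.hasEigenvalue_of_hasEigenvector (x := K *ᵥ v)
    ⟨Module.End.mem_eigenspace_iff.mpr ?_, hK v hv.2⟩
  rw [Matrix.toLin'_apply, hBK, hAv, Matrix.mulVec_smul]

/-- Loop removal, enlargement step, spectral consequence: with `Ap` the
enlarged adjacency matrix obtained by replacing the looped vertex `v₀` by a loopless clique
`C` of `q+1` vertices, and `K` the corresponding `(n+q) × n` isometry, every eigenvalue of
`A` is an eigenvalue of `Ap`, and if `v` is an eigenvector of `A` with eigenvalue `μ`, then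
`K v` is a nonzero eigenvector of `Ap` with the same eigenvalue `μ`. -/
theorem stmt_13 {n : ℕ} (A : Matrix (Fin n) (Fin n) ℝ)
    (hsymm : A.IsSymm)
    (hnonneg : ∀ i j, 0 ≤ A i j)
    (v₀ : Fin n) (ℓ : ℝ) (hℓ : 0 ≤ ℓ) (hℓdef : A v₀ v₀ = ℓ)
    (q : ℕ) (hq : 1 ≤ q)
    (C : Set (Fin n ⊕ Fin q))
    (hC : C = {Sum.inl v₀} ∪ Set.range Sum.inr)
    (Ap : Matrix (Fin n ⊕ Fin q) (Fin n ⊕ Fin q) ℝ)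
    (hAp_diag : ∀ x ∈ C, Ap x x = 0)
    (hAp_clique : ∀ x ∈ C, ∀ y ∈ C, x ≠ y → Ap x y = ℓ / q)
    (hAp_out : ∀ x ∈ C, ∀ j : Fin n, j ≠ v₀ →
      Ap x (Sum.inl j) = A v₀ j / Real.sqrt (q + 1) ∧
      Ap (Sum.inl j) x = A v₀ j / Real.sqrt (q + 1))
    (hAp_rest : ∀ j j' : Fin n, j ≠ v₀ → j' ≠ v₀ →
      Ap (Sum.inl j) (Sum.inl j') = A j j')
    (K : Matrix (Fin n ⊕ Fin q) (Fin n) ℝ)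
    (hK_C : ∀ x ∈ C, K x v₀ = 1 / Real.sqrt (q + 1))
    (hK_C' : ∀ x ∈ C, ∀ j : Fin n, j ≠ v₀ → K x j = 0)
    (hK_rest : ∀ j : Fin n, j ≠ v₀ → ∀ j' : Fin n,
      K (Sum.inl j) j' = if j' = j then 1 else 0) :
    (∀ μ : ℝ, Module.End.HasEigenvalue (Matrix.toLin' A) μ →
        Module.End.HasEigenvalue (Matrix.toLin' Ap) μ) ∧
    (∀ (μ : ℝ) (v : Fin n → ℝ), v ≠ 0 → A.mulVec v = μ • v →
        K.mulVec v ≠ 0 ∧ Ap.mulVec (K.mulVec v) = μ • K.mulVec v) := by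
  have hs : (0 : ℝ) < Real.sqrt (q + 1) := Real.sqrt_pos.mpr (by positivity)
  have hss : Real.sqrt (q + 1) * Real.sqrt (q + 1) = q + 1 :=
    Real.mul_self_sqrt (by positivity)
  have hq0 : (q : ℝ) ≠ 0 := by positivity
  have mem_inl : Sum.inl v₀ ∈ C := by simp [hC]
  have mem_inr : ∀ i, Sum.inr i ∈ C := by simp [hC]
  have mulVec_clique : ∀ x ∈ C, ∀ w, (K *ᵥ w) x = w v₀ / Real.sqrt (q + 1) := by
    intro x hx w
    rw [Matrix.mulVec, dotProduct, Finset.sum_eq_single v₀, hK_C x hx]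
    · ring
    · intro j _ hj
      rw [hK_C' x hx j hj, zero_mul]
    · simp
  have mulVec_rest : ∀ j, j ≠ v₀ → ∀ w, (K *ᵥ w) (Sum.inl j) = w j := by
    intro j hj w
    simp [Matrix.mulVec, dotProduct, hK_rest j hj]
  have sum_split : ∀ x w, (Ap *ᵥ (K *ᵥ w)) x =
      (Ap x (Sum.inl v₀) + ∑ i, Ap x (Sum.inr i)) * (w v₀ / Real.sqrt (q + 1)) +
        ∑ j ∈ Finset.univ.erase v₀, Ap x (Sum.inl j) * w j := by
    intro x w
    have hrest : ∑ j ∈ Finset.univ.erase v₀, Ap x (Sum.inl j) * (K *ᵥ w) (Sum.inl j) =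
        ∑ j ∈ Finset.univ.erase v₀, Ap x (Sum.inl j) * w j :=
      Finset.sum_congr rfl fun j hj => by rw [mulVec_rest j (Finset.ne_of_mem_erase hj)]
    rw [Matrix.mulVec, dotProduct, Fintype.sum_sum_type,
      ← Finset.add_sum_erase _ _ (Finset.mem_univ v₀), hrest, mulVec_clique _ mem_inl]
    simp only [mulVec_clique _ (mem_inr _), ← Finset.sum_mul]
    ring
  have sum_split_A : ∀ j w, (A *ᵥ w) j =
      A j v₀ * w v₀ + ∑ k ∈ Finset.univ.erase v₀, A j k * w k := fun j w =>
    (Finset.add_sum_erase _ (fun k => A j k * w k) (Finset.mem_univ v₀)).symm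
  have clique_sum : ∀ x ∈ C, Ap x (Sum.inl v₀) + ∑ i, Ap x (Sum.inr i) = ℓ := by
    intro x hx
    have hx' := hx
    rw [hC] at hx'
    obtain rfl | ⟨i, rfl⟩ := hx'
    · have hrow : ∀ i, Ap (Sum.inl v₀) (Sum.inr i) = ℓ / q := fun i =>
        hAp_clique _ hx _ (mem_inr i) (by simp)
      simp only [hAp_diag _ hx, hrow, Finset.sum_const, Finset.card_univ, Fintype.card_fin,
        nsmul_eq_mul]
      field_simp
      ring
    · have hrow : ∀ k ∈ Finset.univ.erase i, Ap (Sum.inr i) (Sum.inr k) = ℓ / q := fun k hk =>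
        hAp_clique _ hx _ (mem_inr k) (by simpa using (Finset.ne_of_mem_erase hk).symm)
      rw [← Finset.add_sum_erase _ _ (Finset.mem_univ i), Finset.sum_congr rfl hrow,
        hAp_diag _ hx, hAp_clique _ hx _ mem_inl (by simp), Finset.sum_const,
        Finset.card_erase_of_mem (Finset.mem_univ i), Finset.card_univ, Fintype.card_fin,
        nsmul_eq_mul, Nat.cast_sub hq]
      field_simp
      push_cast
      ring
  have intertwine_clique : ∀ x ∈ C, ∀ w, (Ap *ᵥ (K *ᵥ w)) x = (K *ᵥ (A *ᵥ w)) x := by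
    intro x hx w
    have hrest : ∑ j ∈ Finset.univ.erase v₀, Ap x (Sum.inl j) * w j =
        (∑ j ∈ Finset.univ.erase v₀, A v₀ j * w j) / Real.sqrt (q + 1) := by
      rw [Finset.sum_div]
      refine Finset.sum_congr rfl fun j hj => ?_
      rw [(hAp_out x hx j (Finset.ne_of_mem_erase hj)).1]
      ring
    rw [sum_split, clique_sum x hx, hrest, mulVec_clique x hx, sum_split_A, hℓdef]
    ring
  have intertwine : ∀ w, Ap *ᵥ (K *ᵥ w) = K *ᵥ (A *ᵥ w) := by
    intro w
    ext x
    by_cases hx : x ∈ C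
    · exact intertwine_clique x hx w
    · obtain j | i := x
      · have hj : j ≠ v₀ := by
          rintro rfl
          exact hx mem_inl
        have hcol : ∀ y ∈ C, Ap (Sum.inl j) y = A j v₀ / Real.sqrt (q + 1) := fun y hy => by
          rw [(hAp_out y hy j hj).2, hsymm.apply]
        have hrest : ∑ k ∈ Finset.univ.erase v₀, Ap (Sum.inl j) (Sum.inl k) * w k =
            ∑ k ∈ Finset.univ.erase v₀, A j k * w k :=
          Finset.sum_congr rfl fun k hk => by
            rw [hAp_rest j k hj (Finset.ne_of_mem_erase hk)]
        rw [sum_split, hrest, mulVec_rest j hj, sum_split_A]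
        simp only [hcol _ mem_inl, hcol _ (mem_inr _), Finset.sum_const, Finset.card_univ,
          Fintype.card_fin, nsmul_eq_mul]
        congr 1
        field_simp
        linear_combination (-(A j v₀ * w v₀)) * hss
      · exact absurd (mem_inr i) hx
  have mulVec_ne_zero : ∀ v, v ≠ 0 → K *ᵥ v ≠ 0 := by
    intro v hv h
    refine hv (funext fun j => ?_)
    by_cases hj : j = v₀
    · subst hj
      have := mulVec_clique _ mem_inl v
      rw [h, Pi.zero_apply, eq_comm, div_eq_zero_iff] at this
      exact this.resolve_right hs.ne'
    · rw [← mulVec_rest j hj v, h, Pi.zero_apply, Pi.zero_apply]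
  refine ⟨fun μ => hasEigenvalue_toLin'_of_mulVec_intertwine mulVec_ne_zero intertwine,
    fun μ v hv hAv => ⟨mulVec_ne_zero v hv, ?_⟩⟩
  rw [intertwine, hAv, Matrix.mulVec_smul]
end

section
/- (Loop removal theorem, reduction step, transition matrix.) Let A be an n×n real symmetric matrix with nonnegative entries and all row sums positive, carrying on a subset S, |S| = m ≥ 2, an (m,k,s)-star with loops with loop weight ℓ and central weight a; let d_i denote the row sums and T = D^{-1}A the transition matrix. Let A⁻ be the (n−m+1)×(n−m+1) matrix obtained by collapsing S to a single vertex ⋆ with A⁻ ⋆ ⋆ = m((m−1)a + ℓ), A⁻ ⋆ j = A⁻ j ⋆ = m·(A i₀ j) for j ∉ S (i₀ ∈ S arbitrary), and A⁻ j j' = A j j' otherwise, and let T⁻ = (D⁻)^{-1}A⁻ be its transition matrix. Let H be the n×(n−m+1) matrix with H i ⋆ = 1 for i ∈ S, H j j = 1 for j ∉ S, and 0 otherwise. Then T H = H T⁻; consequently, if v is a right eigenvector of T⁻ with eigenvalue λ then Hv is a nonzero right eigenvector of T with eigenvalue λ, and every (complex) eigenvalue of T⁻ is an eigenvalue of T.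 -/
open Matrix

/-- An intertwining relation `T * H = H * U` with `H` injective transports eigenvectors. -/
theorem Matrix.mulVec_eigenvector_of_intertwining {K ι κ : Type*} [Field K] [Fintype ι]
    [Fintype κ] {T : Matrix ι ι K} {U : Matrix κ κ K} {H : Matrix ι κ K}
    (hTU : T * H = H * U) (hinj : Function.Injective H.mulVec) {lam : K} {v : κ → K}
    (hv : v ≠ 0) (hUv : U *ᵥ v = lam • v) :
    H *ᵥ v ≠ 0 ∧ T *ᵥ (H *ᵥ v) = lam • H *ᵥ v := by
  refine ⟨fun h => hv (hinj (by simpa using h)), ?_⟩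
  rw [mulVec_mulVec, hTU, ← mulVec_mulVec, hUv, mulVec_smul]

theorem Matrix.hasEigenvalue_of_intertwining {K ι κ : Type*} [Field K] [Fintype ι]
    [Fintype κ] [DecidableEq ι] [DecidableEq κ] {T : Matrix ι ι K} {U : Matrix κ κ K}
    {H : Matrix ι κ K} (hTU : T * H = H * U) (hinj : Function.Injective H.mulVec) {lam : K}
    (h : Module.End.HasEigenvalue (toLin' U) lam) :
    Module.End.HasEigenvalue (toLin' T) lam := by
  obtain ⟨v, hv⟩ := h.exists_hasEigenvector
  have key := mulVec_eigenvector_of_intertwining hTU hinj hv.2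
    (by simpa using hv.apply_eq_smul)
  exact Module.End.hasEigenvalue_of_hasEigenvector (Module.End.hasEigenvector_iff.2
    ⟨Module.End.mem_eigenspace_iff.2 (by simpa using key.2), key.1⟩)

/-- The characteristic matrix of a surjection is injective. -/
theorem Matrix.injective_mulVec_one_submatrix {K ι κ : Type*} [NonAssocSemiring K] [Fintype κ]
    [DecidableEq κ] {c : ι → κ} (hc : Function.Surjective c) :
    Function.Injective ((1 : Matrix κ κ K).submatrix c id).mulVec := by
  intro v w h
  funext y
  obtain ⟨i, rfl⟩ := hc y
  simpa [mulVec, dotProduct, one_apply] using congrFun h i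

/-- If row `c i` of `B` is a nonzero multiple of row `i` of `A` with columns collapsed along `c`,
then the row-normalizations of `A` and `B` are intertwined by the characteristic matrix of `c`. -/
theorem Matrix.rowNormalize_intertwining {K ι κ : Type*} [Field K] [Fintype ι]
    [Fintype κ] [DecidableEq ι] [DecidableEq κ] {A : Matrix ι ι K} {B : Matrix κ κ K} {c : ι → κ}
    {w : ι → K} (hw : ∀ i, w i ≠ 0)
    (hAB : ∀ i y, B (c i) y = w i * (A * (1 : Matrix κ κ K).submatrix c id) i y) :
    diagonal (fun i => (∑ j, A i j)⁻¹) * A * (1 : Matrix κ κ K).submatrix c id =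
      (1 : Matrix κ κ K).submatrix c id * (diagonal (fun x => (∑ y, B x y)⁻¹) * B) := by
  have hsum : ∀ i, ∑ y, B (c i) y = w i * ∑ j, A i j := by
    intro i
    simp_rw [hAB, ← Finset.mul_sum, mul_apply]
    rw [Finset.sum_comm]
    simp [one_apply]
  ext i y
  have hright : ((1 : Matrix κ κ K).submatrix c id *
      (diagonal (fun x => (∑ y, B x y)⁻¹) * B)) i y = (∑ y, B (c i) y)⁻¹ * B (c i) y := by
    rw [mul_apply]
    simp [one_apply, diagonal_mul]
  rw [hright, Matrix.mul_assoc, diagonal_mul, hsum, hAB, mul_inv]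
  field_simp [hw i]

/-- The map collapsing the finite set `S` to the single point `none`. -/
def Finset.collapse {α : Type*} [DecidableEq α] (S : Finset α) (i : α) :
    Option {j : α // j ∉ S} :=
  if h : i ∈ S then none else some ⟨i, h⟩

theorem Finset.collapse_of_mem {α : Type*} [DecidableEq α] {S : Finset α} {i : α} (h : i ∈ S) :
    S.collapse i = none := dif_pos h

theorem Finset.collapse_of_notMem {α : Type*} [DecidableEq α] {S : Finset α} {i : α}
    (h : i ∉ S) : S.collapse i = some ⟨i, h⟩ := dif_neg h

theorem Finset.collapse_surjective {α : Type*} [DecidableEq α] {S : Finset α}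
    (hS : S.Nonempty) : Function.Surjective S.collapse := by
  rintro (_ | j)
  · exact ⟨_, collapse_of_mem hS.choose_spec⟩
  · exact ⟨j, collapse_of_notMem j.2⟩

/-- A function equal to `ℓ` at one point of `S` and to `a` at the others. -/
theorem Finset.sum_eq_add_card_sub_one_mul {α K : Type*} [DecidableEq α] [Ring K] {S : Finset α}
    {f : α → K} {i : α} {ℓ a : K} (hi : i ∈ S) (hfi : f i = ℓ)
    (hf : ∀ j ∈ S, j ≠ i → f j = a) : ∑ j ∈ S, f j = (S.card - 1) * a + ℓ := by
  rw [← Finset.sum_erase_add _ _ hi, hfi,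
    Finset.sum_congr rfl fun j hj => hf j (mem_of_mem_erase hj) (ne_of_mem_erase hj)]
  simp [card_erase_of_mem hi, Nat.cast_sub (card_pos.2 ⟨i, hi⟩)]

/-- Loop removal, reduction step, transition matrix: collapsing an
`(m,k,s)`-star with loops on `S` (loop weight `ℓ`, central weight `a`) to the single vertex
`⋆` (= `none`), with loop weight `m((m-1)a + ℓ)` at `⋆` and weights `m · A i₀ j` from `⋆` to
outside vertices, yields `Am` with transition matrix `Tm = (D⁻)⁻¹ Am`; the matrix `H` with
`H i ⋆ = 1` for `i ∈ S` and `H j j = 1` for `j ∉ S` satisfies `T H = H Tm`; consequently a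
right eigenvector `v` of `Tm` with eigenvalue `lam` gives the nonzero right eigenvector
`H v` of `T` with eigenvalue `lam`, and every complex eigenvalue of `Tm` is an eigenvalue
of `T`. -/
theorem stmt_14 {n : ℕ} (A : Matrix (Fin n) (Fin n) ℝ)
    (hsymm : A.IsSymm)
    (hnonneg : ∀ i j, 0 ≤ A i j)
    (hpos : ∀ i, 0 < ∑ j, A i j)
    (S : Finset (Fin n)) (m : ℕ) (hm : 2 ≤ m) (hcard : S.card = m)
    (ℓ a : ℝ) (hℓ : 0 ≤ ℓ) (ha : 0 ≤ a)
    (hloop : ∀ i ∈ S, A i i = ℓ)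
    (hstar_center : ∀ i ∈ S, ∀ j ∈ S, i ≠ j → A i j = a)
    (hstar_out : ∀ i ∈ S, ∀ j ∈ S, ∀ l, l ∉ S → A i l = A j l)
    (i₀ : Fin n) (hi₀ : i₀ ∈ S)
    (T : Matrix (Fin n) (Fin n) ℝ)
    (hT : T = Matrix.diagonal (fun i => (∑ j, A i j)⁻¹) * A)
    (Am : Matrix (Option {j : Fin n // j ∉ S}) (Option {j : Fin n // j ∉ S}) ℝ)
    (hAm_star : Am none none = (m : ℝ) * (((m : ℝ) - 1) * a + ℓ))
    (hAm_out : ∀ j : {j : Fin n // j ∉ S},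
      Am none (some j) = (m : ℝ) * A i₀ (j : Fin n) ∧
      Am (some j) none = (m : ℝ) * A i₀ (j : Fin n))
    (hAm_rest : ∀ j j' : {j : Fin n // j ∉ S},
      Am (some j) (some j') = A (j : Fin n) (j' : Fin n))
    (Tm : Matrix (Option {j : Fin n // j ∉ S}) (Option {j : Fin n // j ∉ S}) ℝ)
    (hTm : Tm = Matrix.diagonal (fun x => (∑ y, Am x y)⁻¹) * Am)
    (H : Matrix (Fin n) (Option {j : Fin n // j ∉ S}) ℝ)
    (hH_star : ∀ i, H i none = if i ∈ S then 1 else 0)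
    (hH_rest : ∀ i, ∀ j : {j : Fin n // j ∉ S},
      H i (some j) = if i = (j : Fin n) then 1 else 0) :
    T * H = H * Tm ∧
    (∀ (lam : ℝ) (v : Option {j : Fin n // j ∉ S} → ℝ), v ≠ 0 →
        Tm.mulVec v = lam • v →
        H.mulVec v ≠ 0 ∧ T.mulVec (H.mulVec v) = lam • H.mulVec v) ∧
    (∀ μ : ℂ, Module.End.HasEigenvalue (Matrix.toLin' (Tm.map Complex.ofReal)) μ →
        Module.End.HasEigenvalue (Matrix.toLin' (T.map Complex.ofReal)) μ) := by
  have hm0 : (m : ℝ) ≠ 0 := by positivity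
  have hH : H = (1 : Matrix _ _ ℝ).submatrix S.collapse id := by
    ext i (_ | j) <;> by_cases hi : i ∈ S
    · rw [hH_star, if_pos hi, submatrix_apply, Finset.collapse_of_mem hi]
      exact (one_apply_eq none).symm
    · simp [hH_star, hi, Finset.collapse_of_notMem hi]
    · have hij : i ≠ j := fun h => j.2 (h ▸ hi)
      simp [hH_rest, hij, Finset.collapse_of_mem hi]
    · simp [hH_rest, Finset.collapse_of_notMem hi, one_apply, Subtype.ext_iff]
  have hstar : ∀ i, (A * H) i none = ∑ j ∈ S, A i j := fun i => by
    simp [mul_apply, hH_star]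
  have hrest : ∀ i (j : {j : Fin n // j ∉ S}), (A * H) i (some j) = A i j := fun i j => by
    simp [mul_apply, hH_rest]
  have hAB : ∀ i y, Am (S.collapse i) y = (if i ∈ S then (m : ℝ) else 1) * (A * H) i y := by
    rintro i (_ | j) <;> by_cases hi : i ∈ S
    · rw [Finset.collapse_of_mem hi, if_pos hi, hAm_star, hstar,
        Finset.sum_eq_add_card_sub_one_mul hi (hloop i hi)
          fun j hj hji => hstar_center i hi j hj hji.symm, hcard]
    · rw [Finset.collapse_of_notMem hi, if_neg hi, (hAm_out _).2, hstar, one_mul,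
        Finset.sum_congr rfl fun j hj =>
          (hsymm.apply j i).trans (hstar_out j hj i₀ hi₀ i hi)]
      simp [hcard]
    · rw [Finset.collapse_of_mem hi, if_pos hi, (hAm_out j).1, hrest,
        hstar_out i hi i₀ hi₀ j j.2]
    · rw [Finset.collapse_of_notMem hi, if_neg hi, hAm_rest, hrest, one_mul]
  have hTH : T * H = H * Tm := by
    rw [hH] at hAB ⊢
    rw [hT, hTm]
    exact rowNormalize_intertwining (fun i => by split_ifs <;> simp [hm0]) hAB
  have hsurj := Finset.collapse_surjective ⟨i₀, hi₀⟩
  refine ⟨hTH, fun lam v hv hTv => mulVec_eigenvector_of_intertwining hTH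
    (hH ▸ injective_mulVec_one_submatrix hsurj) hv hTv, fun μ hμ => ?_⟩
  refine hasEigenvalue_of_intertwining (H := H.map Complex.ofReal) ?_ ?_ hμ
  · have h := congrArg (fun M => M.map Complex.ofRealHom) hTH
    simp only [Matrix.map_mul] at h
    exact h
  · rw [hH, ← submatrix_map, Matrix.map_one _ Complex.ofReal_zero Complex.ofReal_one]
    exact injective_mulVec_one_submatrix hsurj
end

section
/- (Loop removal theorem, enlargement step, transition matrix.) Let A be an n×n real symmetric matrix with nonnegative entries and all row sums positive, with a distinguished vertex v₀ with loop weight ℓ = A v₀ v₀ > 0, and let T = D^{-1}A be the transition matrix. For q ≥ 1 let A⁺ be the (n+q)×(n+q) matrix obtained by replacing v₀ with a loopless clique C of q+1 vertices with A⁺ i i' = ℓ/(q(q+1)) for distinct i, i' ∈ C, A⁺ i j = A⁺ j i = (A v₀ j)/(q+1) for i ∈ C and j ∉ C, and A⁺ unchanged off C; let T⁺ = (D⁺)^{-1}A⁺ be its transition matrix. Let K be the (n+q)×n matrix with K i v₀ = 1 for i ∈ C, K j j = 1 for j ∉ C, and 0 otherwise. Then T⁺ K = K T; consequently, if v is a right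 eigenvector of T with eigenvalue λ then Kv is a nonzero right eigenvector of T⁺ with eigenvalue λ, and every (complex) eigenvalue of T is an eigenvalue of T⁺. -/
open Matrix

/-- The matrix of the map `π`, with a single `1` in each row, intertwines the transition matrices
of two weighted graphs as soon as the weights from `x` into the fibres of `π` are proportional to
the weights out of `π x`. -/
theorem transition_mul_eq_of_lumpable {ι κ : Type*} [Fintype ι] [Fintype κ] [DecidableEq ι]
    [DecidableEq κ] (π : κ → ι) (K : Matrix κ ι ℝ) (hK : ∀ x j, K x j = if j = π x then 1 else 0)
    (A : Matrix ι ι ℝ) (B : Matrix κ κ ℝ) (c : κ → ℝ) (hc : ∀ x, c x ≠ 0)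
    (h : ∀ x j, (B * K) x j = c x * A (π x) j) :
    (diagonal (fun x => (∑ y, B x y)⁻¹) * B) * K =
      K * (diagonal (fun i => (∑ j, A i j)⁻¹) * A) := by
  have hsum (x : κ) : ∑ y, B x y = c x * ∑ j, A (π x) j := by
    simp only [Finset.mul_sum, ← h, mul_apply, hK]
    rw [Finset.sum_comm]
    simp
  ext x j
  rw [Matrix.mul_assoc, diagonal_mul, h, hsum, mul_apply]
  simp only [hK, ite_mul, one_mul, zero_mul, Finset.sum_ite_eq',
    Finset.mem_univ, if_true, diagonal_mul, mul_inv]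
  field_simp [hc x]

/-- An injective intertwiner maps eigenvectors to eigenvectors. -/
theorem mulVec_eigenvector_of_intertwine {R ι κ : Type*} [CommRing R] [Fintype ι] [Fintype κ]
    {S : Matrix κ κ R} {T : Matrix ι ι R} {K : Matrix κ ι R} (h : S * K = K * T)
    (hK : Function.Injective K.mulVec) {a : R} {v : ι → R} (hv : v ≠ 0)
    (hTv : T *ᵥ v = a • v) : K *ᵥ v ≠ 0 ∧ S *ᵥ (K *ᵥ v) = a • (K *ᵥ v) := by
  refine ⟨fun h0 => hv (hK (by simpa using h0)), ?_⟩
  rw [mulVec_mulVec, h, ← mulVec_mulVec, hTv, mulVec_smul]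

/-- Loop removal, enlargement step, transition matrix: replacing a looped
vertex `v₀` (loop weight `ℓ = A v₀ v₀ > 0`) by a loopless clique `C` of `q+1` vertices
(`C = {inl v₀} ∪ range inr` in `Fin n ⊕ Fin q`), with pairwise weights `ℓ/(q(q+1))` inside
`C` and weights `A v₀ j / (q+1)` from `C` to each former neighbor `j`, yields `Ap` with
transition matrix `Tp = (D⁺)⁻¹ Ap`; the matrix `K` with `K x v₀ = 1` for `x ∈ C` and
`K j j = 1` for `j ∉ C` satisfies `Tp K = K T`; consequently a right eigenvector `v` of `T`
with eigenvalue `lam` gives the nonzero right eigenvector `K v` of `Tp` with eigenvalue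
`lam`, and every complex eigenvalue of `T` is an eigenvalue of `Tp`. -/
theorem stmt_15 {n : ℕ} (A : Matrix (Fin n) (Fin n) ℝ)
    (hsymm : A.IsSymm)
    (hnonneg : ∀ i j, 0 ≤ A i j)
    (hpos : ∀ i, 0 < ∑ j, A i j)
    (v₀ : Fin n) (ℓ : ℝ) (hℓ : 0 < ℓ) (hℓdef : A v₀ v₀ = ℓ)
    (q : ℕ) (hq : 1 ≤ q)
    (T : Matrix (Fin n) (Fin n) ℝ)
    (hT : T = Matrix.diagonal (fun i => (∑ j, A i j)⁻¹) * A)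
    (C : Set (Fin n ⊕ Fin q))
    (hC : C = {Sum.inl v₀} ∪ Set.range Sum.inr)
    (Ap : Matrix (Fin n ⊕ Fin q) (Fin n ⊕ Fin q) ℝ)
    (hAp_diag : ∀ x ∈ C, Ap x x = 0)
    (hAp_clique : ∀ x ∈ C, ∀ y ∈ C, x ≠ y → Ap x y = ℓ / (q * (q + 1)))
    (hAp_out : ∀ x ∈ C, ∀ j : Fin n, j ≠ v₀ →
      Ap x (Sum.inl j) = A v₀ j / (q + 1) ∧
      Ap (Sum.inl j) x = A v₀ j / (q + 1))
    (hAp_rest : ∀ j j' : Fin n, j ≠ v₀ → j' ≠ v₀ →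
      Ap (Sum.inl j) (Sum.inl j') = A j j')
    (Tp : Matrix (Fin n ⊕ Fin q) (Fin n ⊕ Fin q) ℝ)
    (hTp : Tp = Matrix.diagonal (fun x => (∑ y, Ap x y)⁻¹) * Ap)
    (K : Matrix (Fin n ⊕ Fin q) (Fin n) ℝ)
    (hK_C : ∀ x ∈ C, K x v₀ = 1)
    (hK_C' : ∀ x ∈ C, ∀ j : Fin n, j ≠ v₀ → K x j = 0)
    (hK_rest : ∀ j : Fin n, j ≠ v₀ → ∀ j' : Fin n,
      K (Sum.inl j) j' = if j' = j then 1 else 0) :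
    Tp * K = K * T ∧
    (∀ (lam : ℝ) (v : Fin n → ℝ), v ≠ 0 → T.mulVec v = lam • v →
        K.mulVec v ≠ 0 ∧ Tp.mulVec (K.mulVec v) = lam • K.mulVec v) ∧
    (∀ μ : ℂ, Module.End.HasEigenvalue (Matrix.toLin' (T.map Complex.ofReal)) μ →
        Module.End.HasEigenvalue (Matrix.toLin' (Tp.map Complex.ofReal)) μ) := by
  have hC_inl : Sum.inl v₀ ∈ C := by simp [hC]
  have hC_inr (k : Fin q) : Sum.inr k ∈ C := by simp [hC]
  have hq0 : (q : ℝ) ≠ 0 := by positivity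
  have hq1 : (q : ℝ) + 1 ≠ 0 := by positivity
  set π : Fin n ⊕ Fin q → Fin n := Sum.elim id (fun _ => v₀) with hπ
  have hK (x : Fin n ⊕ Fin q) (j : Fin n) : K x j = if j = π x then 1 else 0 := by
    have hKC (y : Fin n ⊕ Fin q) (hy : y ∈ C) : K y j = if j = v₀ then 1 else 0 := by
      split_ifs with hj
      · rw [hj, hK_C y hy]
      · exact hK_C' y hy j hj
    rcases x with i | k
    · by_cases hi : i = v₀
      · subst hi
        exact hKC _ hC_inl
      · exact hK_rest i hi j
    · exact hKC _ (hC_inr k)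
  have hApK (x : Fin n ⊕ Fin q) (j : Fin n) :
      (Ap * K) x j = Ap x (Sum.inl j) + if j = v₀ then ∑ k, Ap x (Sum.inr k) else 0 := by
    rw [mul_apply, Fintype.sum_sum_type]
    congr 1
    · simp [hK, hπ]
    · split_ifs with hj <;> simp [hK, hπ, hj]
  classical
  have hlump (x : Fin n ⊕ Fin q) (j : Fin n) :
      (Ap * K) x j = (if x ∈ C then ((q : ℝ) + 1)⁻¹ else 1) * A (π x) j := by
    by_cases hx : x ∈ C
    · have hπx : π x = v₀ := by
        rw [hC] at hx
        rcases hx with rfl | ⟨k, rfl⟩ <;> rfl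
      rw [hApK, if_pos hx, hπx]
      by_cases hj : j = v₀
      · have hrow : Ap x (Sum.inl v₀) + ∑ k, Ap x (Sum.inr k) = q * (ℓ / (q * (q + 1))) := by
          rw [hC] at hx
          rcases hx with rfl | ⟨k, rfl⟩
          · rw [hAp_diag _ hC_inl, Finset.sum_congr rfl fun k _ =>
              hAp_clique _ hC_inl _ (hC_inr k) Sum.inl_ne_inr]
            simp
          · rw [hAp_clique _ (hC_inr k) _ hC_inl Sum.inr_ne_inl,
              ← Finset.add_sum_erase _ _ (Finset.mem_univ k), hAp_diag _ (hC_inr k),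
              Finset.sum_congr rfl fun k' hk' => hAp_clique _ (hC_inr k) _ (hC_inr k')
                fun h => Finset.ne_of_mem_erase hk' (Sum.inr_injective h).symm]
            simp [Nat.cast_sub hq]
            ring
        rw [if_pos hj, hj, hrow, hℓdef]
        field_simp
      · rw [if_neg hj, (hAp_out x hx j hj).1]
        ring
    · rcases x with i | k
      · have hi : i ≠ v₀ := fun h => hx (h ▸ hC_inl)
        rw [hApK, if_neg hx]
        by_cases hj : j = v₀
        · subst hj
          rw [if_pos rfl, (hAp_out _ hC_inl i hi).2,
            Finset.sum_congr rfl fun k _ => (hAp_out _ (hC_inr k) i hi).2, ← hsymm.apply j i]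
          simp [hπ]
          field_simp
          ring
        · simp [hj, hAp_rest i j hi hj, hπ]
      · exact absurd (hC_inr k) hx
  have hTK : Tp * K = K * T := by
    rw [hTp, hT]
    refine transition_mul_eq_of_lumpable π K hK A Ap _ (fun x => ?_) hlump
    split_ifs
    · exact inv_ne_zero hq1
    · exact one_ne_zero
  have hinj : Function.Injective K.mulVec := fun v w hvw => funext fun j => by
    simpa [mulVec, dotProduct, hK, hπ] using congrFun hvw (Sum.inl j)
  have hinjC : Function.Injective (K.map Complex.ofReal).mulVec := fun v w hvw => funext fun j => by
    simpa [mulVec, dotProduct, hK, hπ, apply_ite Complex.ofReal] using congrFun hvw (Sum.inl j)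
  have hTKC : Tp.map Complex.ofReal * K.map Complex.ofReal =
      K.map Complex.ofReal * T.map Complex.ofReal := by
    have := congrArg (fun M => M.map Complex.ofRealHom) hTK
    rw [Matrix.map_mul, Matrix.map_mul] at this
    exact this
  refine ⟨hTK, fun lam v hv hTv => mulVec_eigenvector_of_intertwine hTK hinj hv hTv,
    fun μ hμ => ?_⟩
  obtain ⟨v, hv⟩ := hμ.exists_hasEigenvector
  obtain ⟨hne, heig⟩ := mulVec_eigenvector_of_intertwine hTKC hinjC hv.2
    (by simpa only [toLin'_apply] using hv.apply_eq_smul)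
  exact Module.End.hasEigenvalue_of_hasEigenvector
    (Module.End.hasEigenvector_iff.2 ⟨Module.End.mem_eigenspace_iff.2 heig, hne⟩)
end
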